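/- For every α > (ln 2)/π, ∫_0^{π/2} ln(cosh(x/α) + cos(ln(2 cos x)/α)) dx = (π/2)·ln 2 + π·ln ∏_{n=1}^∞ (1 + e^{-παn}). -/

import Mathlib

open Real

open Filter Topology MeasureTheory

theorem Complex.norm_cos_sq (w : ℂ) :
    ‖Complex.cos w‖ ^ 2 = (Real.cosh (2 * w.im) + Real.cos (2 * w.re)) / 2 := by
  rw [Complex.sq_norm, Complex.normSq_apply, Complex.cos_eq w]
  simp only [Complex.sub_re, Complex.sub_im, Complex.mul_re, Complex.mul_im, Complex.I_re,
    Complex.I_im, ← Complex.ofReal_cos, ← Complex.ofReal_sin, ← Complex.ofReal_cosh,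
    ← Complex.ofReal_sinh, Complex.ofReal_re, Complex.ofReal_im]
  rw [Real.cosh_two_mul, Real.cos_two_mul]
  nlinarith [Real.sin_sq_add_cos_sq w.re, Real.cosh_sq w.im]

theorem Complex.abs_im_le_norm_cos (w : ℂ) : |w.im| ≤ ‖Complex.cos w‖ := by
  refine abs_le_of_sq_le_sq ?_ (norm_nonneg _)
  rw [Complex.norm_cos_sq]
  have h1 : |w.im| ≤ |Real.sinh w.im| := by
    rw [Real.abs_sinh]
    exact Real.self_le_sinh_iff.mpr (abs_nonneg _)
  have := sq_le_sq.mpr h1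
  rw [Real.cosh_two_mul, Real.cos_two_mul]
  nlinarith [Real.cosh_sq w.im, sq_nonneg (Real.cos w.re)]

theorem Complex.norm_cos_le_cosh (w : ℂ) : ‖Complex.cos w‖ ≤ Real.cosh w.im := by
  refine (pow_le_pow_iff_left₀ (norm_nonneg _) (Real.cosh_pos _).le two_ne_zero).mp ?_
  rw [Complex.norm_cos_sq, Real.cosh_two_mul]
  nlinarith [Real.cosh_sq w.im, Real.cos_le_one (2 * w.re)]

/-- The function `cos (log (1 + z) / (2 α))`, whose logarithmic circle average on the unit circle
is the integral to be computed. -/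
noncomputable def cosLog (α : ℝ) (z : ℂ) : ℂ := Complex.cos (Complex.log (1 + z) / (2 * α))

/-- The zeros of `cosLog α` in the unit disc. -/
noncomputable def cosLogZero (α : ℝ) (k : ℕ) : ℝ := Real.exp (-π * α * (2 * k + 1)) - 1

theorem im_log_div (α : ℝ) (w : ℂ) :
    (Complex.log w / (2 * α)).im = w.arg / (2 * α) := by
  rw [show (2 * α : ℂ) = ((2 * α : ℝ) : ℂ) by push_cast; rfl, Complex.div_ofReal_im,
    Complex.log_im]

theorem re_log_div (α : ℝ) (w : ℂ) :
    (Complex.log w / (2 * α)).re = Real.log ‖w‖ / (2 * α) := by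
  rw [show (2 * α : ℂ) = ((2 * α : ℝ) : ℂ) by push_cast; rfl, Complex.div_ofReal_re,
    Complex.log_re]

theorem hasDerivAt_cosLog (α : ℝ) {z : ℂ} (hz : 1 + z ∈ Complex.slitPlane) :
    HasDerivAt (cosLog α)
      (-Complex.sin (Complex.log (1 + z) / (2 * α)) * ((1 + z)⁻¹ / (2 * α))) z := by
  have h1 : HasDerivAt (fun z : ℂ ↦ 1 + z) 1 z := (hasDerivAt_id z).const_add 1
  simpa using! ((h1.clog hz).div_const (2 * α : ℂ)).ccos

theorem analyticAt_cosLog (α : ℝ) {z : ℂ} (hz : 1 + z ∈ Complex.slitPlane) :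
    AnalyticAt ℂ (cosLog α) z := by
  have h : AnalyticAt ℂ (fun z : ℂ ↦ Complex.log (1 + z) / (2 * α)) z :=
    (AnalyticAt.clog (by fun_prop) hz).div_const
  exact Complex.analyticAt_cos.comp h

theorem cosLogZero_mem_Ioo {α : ℝ} (hα : 0 < α) (k : ℕ) : cosLogZero α k ∈ Set.Ioo (-1) 0 := by
  have : -π * α * (2 * k + 1) < 0 := by
    have : 0 < π * α * (2 * k + 1) := by positivity
    linarith
  have h1 := Real.exp_lt_one_iff.mpr this
  have h2 := Real.exp_pos (-π * α * (2 * k + 1))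
  unfold cosLogZero
  constructor <;> linarith

theorem cosLogZero_injective {α : ℝ} (hα : 0 < α) : Function.Injective (cosLogZero α) := by
  intro j k h
  have h := Real.exp_injective (sub_left_injective h)
  have h0 : -π * α ≠ 0 := mul_ne_zero (neg_ne_zero.mpr pi_ne_zero) hα.ne'
  have := mul_left_cancel₀ h0 h
  have h2 : (j : ℝ) = k := by linarith
  exact_mod_cast h2

theorem cosLog_cosLogZero {α : ℝ} (hα : 0 < α) (k : ℕ) : cosLog α (cosLogZero α k) = 0 := by
  have hα' : (α : ℂ) ≠ 0 := by exact_mod_cast hα.ne'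
  rw [cosLog, Complex.cos_eq_zero_iff]
  refine ⟨-k - 1, ?_⟩
  have : (1 + (cosLogZero α k : ℂ)) = ((Real.exp (-π * α * (2 * k + 1)) : ℝ) : ℂ) := by
    rw [cosLogZero]; push_cast; ring
  rw [this, ← Complex.ofReal_log (Real.exp_pos _).le, Real.log_exp]
  push_cast
  field_simp
  ring

theorem cosLog_eq_zero_iff {α : ℝ} (hα0 : 0 < α) (hα : Real.log 2 / π < α) {z : ℂ}
    (hz : ‖z‖ < 1) : cosLog α z = 0 ↔ z ∈ Set.range (fun k ↦ (cosLogZero α k : ℂ)) := by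
  have hα' : (α : ℂ) ≠ 0 := by exact_mod_cast hα0.ne'
  refine ⟨fun h ↦ ?_, ?_⟩
  · rw [cosLog, Complex.cos_eq_zero_iff] at h
    obtain ⟨k, hk⟩ := h
    have hlog : Complex.log (1 + z) = ((π * α * (2 * k + 1) : ℝ) : ℂ) := by
      rw [div_eq_iff (by simpa using hα')] at hk
      rw [hk]; push_cast; ring
    have hne : 1 + z ≠ 0 := Complex.slitPlane_ne_zero (Complex.mem_slitPlane_of_norm_lt_one hz)
    have hexp : 1 + z = ((Real.exp (π * α * (2 * k + 1)) : ℝ) : ℂ) := by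
      rw [← Complex.exp_log hne, hlog, Complex.ofReal_exp]
    have hlt : Real.exp (π * α * (2 * k + 1)) < 2 := by
      have h1 : ‖1 + z‖ < 2 := by
        have := norm_add_le (1 : ℂ) z
        rw [norm_one] at this
        linarith
      rwa [hexp, Complex.norm_real, Real.norm_of_nonneg (Real.exp_pos _).le] at h1
    have hlt2 : π * α * (2 * k + 1) < Real.log 2 := (Real.lt_log_iff_exp_lt two_pos).mpr hlt
    have hαπ : Real.log 2 < π * α := by
      rw [div_lt_iff₀ pi_pos] at hα; linarith
    have hk0 : k < 0 := by
      by_contra! hk0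
      have : (0 : ℝ) ≤ k := by exact_mod_cast hk0
      nlinarith [mul_pos pi_pos hα0]
    obtain ⟨m, rfl⟩ : ∃ m : ℕ, k = -m - 1 := ⟨(-k - 1).toNat, by omega⟩
    refine ⟨m, ?_⟩
    have : (-π * α * (2 * m + 1)) = (π * α * (2 * ((-m - 1 : ℤ) : ℝ) + 1)) := by
      push_cast; ring
    simp only [cosLogZero]
    rw [this, Complex.ofReal_sub, ← hexp]
    simp
  · rintro ⟨k, rfl⟩
    exact cosLog_cosLogZero hα0 k

theorem analyticOrderAt_cosLog {α : ℝ} (hα : α ≠ 0) {z : ℂ} (hz : 1 + z ∈ Complex.slitPlane)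
    (h : cosLog α z = 0) : analyticOrderAt (cosLog α) z = 1 := by
  refine (analyticAt_cosLog α hz).analyticOrderAt_eq_one_of_zero_deriv_ne_zero h ?_
  rw [(hasDerivAt_cosLog α hz).deriv]
  have hα' : (α : ℂ) ≠ 0 := by exact_mod_cast hα
  have hsin : Complex.sin (Complex.log (1 + z) / (2 * α)) ≠ 0 := by
    intro hs
    have := Complex.sin_sq_add_cos_sq (Complex.log (1 + z) / (2 * α))
    rw [cosLog] at h
    rw [hs, h] at this
    simp at this
  have := Complex.slitPlane_ne_zero hz
  simp [hsin, hα', this]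

theorem circleAverage_log_norm_cosLog {α : ℝ} (hα0 : 0 < α) (hα : Real.log 2 / π < α) {r : ℝ}
    (hr0 : 0 < r) (hr1 : r < 1) :
    circleAverage (Real.log ‖cosLog α ·‖) 0 r
      = ∑' k : ℕ, max 0 (Real.log (r * (-cosLogZero α k)⁻¹)) := by
  have hball {z : ℂ} (hz : z ∈ Metric.closedBall (0 : ℂ) |r|) : ‖z‖ ≤ r := by
    simpa [abs_of_pos hr0] using hz
  have hslit {z : ℂ} (hz : z ∈ Metric.closedBall (0 : ℂ) |r|) : 1 + z ∈ Complex.slitPlane :=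
    Complex.mem_slitPlane_of_norm_lt_one ((hball hz).trans_lt hr1)
  have han : AnalyticOnNhd ℂ (cosLog α) (Metric.closedBall 0 |r|) :=
    fun z hz ↦ analyticAt_cosLog α (hslit hz)
  have h0 : cosLog α 0 = 1 := by simp [cosLog]
  rw [han.circleAverage_log_norm hr0.ne' (by simp [h0]), h0]
  set D := MeromorphicOn.divisor (cosLog α) (Metric.closedBall 0 |r|)
  have hfin : D.support.Finite := D.finiteSupport (isCompact_closedBall 0 |r|)
  have hinj : Function.Injective (fun k ↦ (cosLogZero α k : ℂ)) :=
    Complex.ofReal_injective.comp (cosLogZero_injective hα0)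
  rw [← tsum_eq_finsum (L := .unconditional ℂ), ← hinj.tsum_eq, norm_one, Real.log_one, add_zero]
  · refine tsum_congr fun k ↦ ?_
    have hk := cosLogZero_mem_Ioo hα0 k
    have hnorm : ‖(cosLogZero α k : ℂ)‖ = -cosLogZero α k := by
      rw [Complex.norm_real, Real.norm_of_nonpos hk.2.le]
    have hpos : 0 < -cosLogZero α k := by linarith [hk.2]
    rw [zero_sub, norm_neg, hnorm]
    by_cases hmem : (cosLogZero α k : ℂ) ∈ Metric.closedBall (0 : ℂ) |r|
    · have hle := hball hmem
      rw [hnorm] at hle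
      rw [MeromorphicOn.AnalyticOnNhd.divisor_apply han hmem,
        analyticOrderAt_cosLog hα0.ne' (hslit hmem) (cosLog_cosLogZero hα0 k), max_eq_right]
      · simp
      · apply Real.log_nonneg
        rw [← div_eq_mul_inv, one_le_div hpos]
        exact hle
    · rw [D.apply_eq_zero_of_notMem hmem, max_eq_left]
      · simp
      · apply Real.log_nonpos (by positivity)
        rw [← div_eq_mul_inv, div_le_one hpos]
        rw [Metric.mem_closedBall, dist_zero_right, hnorm, abs_of_pos hr0] at hmem
        linarith
  · intro z hz
    have hDz : D z ≠ 0 := by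
      intro h; simp [h] at hz
    have hmem := D.supportWithinDomain hDz
    rw [← cosLog_eq_zero_iff hα0 hα ((hball hmem).trans_lt hr1)]
    by_contra hne
    apply hDz
    rw [MeromorphicOn.AnalyticOnNhd.divisor_apply han hmem, (han z hmem).analyticOrderAt_eq_zero.mpr hne]
    simp
  · refine hfin.subset fun z hz ↦ ?_
    intro h; simp [h] at hz

theorem summable_exp_neg_mul {c : ℝ} (hc : 0 < c) :
    Summable fun n : ℕ ↦ Real.exp (-c * (n + 1)) := by
  have := (summable_nat_add_iff 1).mpr
    (Real.summable_exp_nat_mul_iff.mpr (neg_neg_iff_pos.mpr hc) : Summable fun n : ℕ ↦ _)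
  refine this.congr fun n ↦ ?_
  push_cast; ring_nf

/-- Euler's identity between the products `∏ (1 + q ^ n)` and `∏ (1 - q ^ (2 n - 1))⁻¹`, in
logarithmic form. -/
theorem tsum_log_one_add_exp {c : ℝ} (hc : 0 < c) :
    ∑' n : ℕ, Real.log (1 + Real.exp (-c * (n + 1)))
      = -∑' n : ℕ, Real.log (1 - Real.exp (-c * (2 * n + 1))) := by
  set g : ℕ → ℝ := fun n ↦ Real.log (1 - Real.exp (-c * (n + 1))) with hg
  have hgs : Summable g := by
    simpa [hg, sub_eq_add_neg] using
      Real.summable_log_one_add_of_summable (summable_exp_neg_mul hc).neg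
  have hodd : Summable fun n ↦ g (2 * n + 1) :=
    hgs.comp_injective (i := fun n : ℕ ↦ 2 * n + 1) fun a b h ↦ by simpa using h
  have heven : Summable fun n ↦ g (2 * n) :=
    hgs.comp_injective (i := fun n : ℕ ↦ 2 * n) fun a b h ↦ by simpa using h
  have hterm (n : ℕ) : Real.log (1 + Real.exp (-c * (n + 1))) = g (2 * n + 1) - g n := by
    have hlt : Real.exp (-c * (n + 1)) < 1 := by
      apply Real.exp_lt_one_iff.mpr
      have : 0 < c * (n + 1) := by positivity
      linarith
    have hpos := Real.exp_pos (-c * (n + 1))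
    have : 1 - Real.exp (-c * ((2 * n + 1 : ℕ) + 1))
        = (1 + Real.exp (-c * (n + 1))) * (1 - Real.exp (-c * (n + 1))) := by
      have : Real.exp (-c * ((2 * n + 1 : ℕ) + 1)) = Real.exp (-c * (n + 1)) ^ 2 := by
        rw [← Real.exp_nat_mul]; push_cast; ring_nf
      rw [this]; ring
    simp only [hg]
    rw [this, Real.log_mul (by positivity) (by linarith)]
    ring
  have hsplit := tsum_even_add_odd heven hodd
  simp_rw [hterm]
  rw [hodd.tsum_sub hgs, ← hsplit]
  simp [hg]

theorem summable_log_neg_cosLogZero {α : ℝ} (hα0 : 0 < α) :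
    Summable fun k ↦ Real.log (-cosLogZero α k)⁻¹ := by
  have h := (summable_exp_neg_mul (mul_pos pi_pos hα0)).comp_injective
    (i := fun n : ℕ ↦ 2 * n) fun a b h ↦ by simpa using h
  refine (Real.summable_log_one_add_of_summable h.neg).neg.congr fun k ↦ ?_
  rw [Real.log_inv, cosLogZero]
  simp only [Function.comp_apply]
  push_cast
  ring_nf

theorem tendsto_tsum_max_log {α : ℝ} (hα0 : 0 < α) :
    Tendsto (fun r : ℝ ↦ ∑' k : ℕ, max 0 (Real.log (r * (-cosLogZero α k)⁻¹))) (𝓝[<] 1)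
      (𝓝 (∑' k : ℕ, Real.log (-cosLogZero α k)⁻¹)) := by
  have hinv (k : ℕ) : 1 ≤ (-cosLogZero α k)⁻¹ := by
    have hk := cosLogZero_mem_Ioo hα0 k
    exact (one_le_inv₀ (by linarith [hk.2])).mpr (by linarith [hk.1])
  refine tendsto_tsum_of_dominated_convergence (summable_log_neg_cosLogZero hα0) (fun k ↦ ?_) ?_
  · have hlim : Tendsto (fun r : ℝ ↦ max 0 (Real.log (r * (-cosLogZero α k)⁻¹))) (𝓝 1)
        (𝓝 (max 0 (Real.log (1 * (-cosLogZero α k)⁻¹)))) := by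
      refine tendsto_const_nhds.max (Tendsto.log ?_ ?_)
      · exact tendsto_id.mul_const _
      · linarith [hinv k]
    rw [one_mul, max_eq_right (Real.log_nonneg (hinv k))] at hlim
    exact hlim.mono_left nhdsWithin_le_nhds
  · filter_upwards [Ioo_mem_nhdsLT (zero_lt_one (α := ℝ))] with r hr k
    have := hinv k
    have hr0 := hr.1
    rw [Real.norm_of_nonneg (le_max_left _ _)]
    refine max_le (Real.log_nonneg this) (Real.log_le_log (by positivity) ?_)
    nlinarith [hr.2]

theorem abs_log_norm_cosLog_circleMap_le {α : ℝ} (hα0 : 0 < α) {r θ : ℝ} (hr : 1 / 2 ≤ r)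
    (hr1 : r ≤ 1) (hθ : Real.sin θ ≠ 0) :
    |Real.log ‖cosLog α (circleMap 0 r θ)‖|
      ≤ Real.log (Real.cosh (π / (2 * α))) + |Real.log (8 * α)| + |Real.log (Real.sin θ)| := by
  set z := circleMap 0 r θ with hz
  have him : (1 + z).im = r * Real.sin θ := by simp [hz, circleMap_zero_im]
  have hne : 1 + z ≠ 0 := by
    intro h
    rw [h, Complex.zero_im] at him
    exact mul_ne_zero (by linarith) hθ him.symm
  have hnorm : ‖1 + z‖ ≤ 2 := by
    have := norm_add_le (1 : ℂ) z
    rw [norm_one, hz, norm_circleMap_zero, abs_of_nonneg (by linarith)] at this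
    linarith
  have hnpos : 0 < ‖1 + z‖ := norm_pos_iff.mpr hne
  have harg : |Real.sin θ| / 4 ≤ |(1 + z).arg| := by
    refine le_trans ?_ Real.abs_sin_le_abs
    rw [Complex.sin_arg, him, abs_div, abs_mul, abs_of_nonneg (by linarith : 0 ≤ r),
      abs_of_pos hnpos, le_div_iff₀ hnpos]
    nlinarith [abs_nonneg (Real.sin θ)]
  have hlow : |Real.sin θ| / (8 * α) ≤ ‖cosLog α z‖ := by
    refine le_trans ?_ (Complex.abs_im_le_norm_cos _)
    rw [im_log_div, abs_div, abs_of_pos (by positivity : 0 < 2 * α), div_le_div_iff₀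
      (by positivity) (by positivity)]
    nlinarith
  have hup : ‖cosLog α z‖ ≤ Real.cosh (π / (2 * α)) := by
    refine (Complex.norm_cos_le_cosh _).trans ?_
    rw [Real.cosh_le_cosh, im_log_div, abs_div, abs_div, abs_of_pos pi_pos]
    gcongr
    exact Complex.abs_arg_le_pi _
  have hspos : 0 < |Real.sin θ| := abs_pos.mpr hθ
  have h1 := Real.log_le_log (by positivity) hlow
  have h2 := Real.log_le_log (lt_of_lt_of_le (by positivity) hlow) hup
  rw [Real.log_div hspos.ne' (by positivity), Real.log_abs] at h1
  have h3 : 0 ≤ Real.log (Real.cosh (π / (2 * α))) := Real.log_nonneg (Real.one_le_cosh _)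
  rw [abs_le]
  constructor
  · linarith [le_abs_self (Real.log (8 * α)), neg_abs_le (Real.log (Real.sin θ))]
  · linarith [abs_nonneg (Real.log (8 * α)), abs_nonneg (Real.log (Real.sin θ))]

theorem intervalIntegrable_log_norm_cosLog_bound (α a b : ℝ) :
    IntervalIntegrable (fun θ ↦ Real.log (Real.cosh (π / (2 * α))) + |Real.log (8 * α)|
      + |Real.log (Real.sin θ)|) volume a b :=
  intervalIntegrable_const.add (intervalIntegrable_log_sin (a := a) (b := b)).abs

theorem ae_sin_ne_zero : ∀ᵐ θ : ℝ, Real.sin θ ≠ 0 := by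
  have : {θ : ℝ | Real.sin θ = 0} = Set.range fun n : ℤ ↦ (n : ℝ) * π := by
    ext θ; simp [Real.sin_eq_zero_iff]
  rw [ae_iff]
  simp only [not_not]
  rw [this]
  exact (Set.countable_range _).measure_zero _

theorem measurable_log_norm_cosLog (α r : ℝ) :
    Measurable fun θ ↦ Real.log ‖cosLog α (circleMap 0 r θ)‖ := by
  have h : Measurable fun θ ↦ circleMap 0 r θ := (continuous_circleMap 0 r).measurable
  unfold cosLog
  fun_prop

theorem intervalIntegrable_log_norm_cosLog {α : ℝ} (hα0 : 0 < α) (a b : ℝ) :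
    IntervalIntegrable (fun θ ↦ Real.log ‖cosLog α (circleMap 0 1 θ)‖) volume a b := by
  refine (intervalIntegrable_log_norm_cosLog_bound α a b).mono_fun'
    (measurable_log_norm_cosLog α 1).aestronglyMeasurable (ae_restrict_of_ae ?_)
  filter_upwards [ae_sin_ne_zero] with θ hθ
  exact abs_log_norm_cosLog_circleMap_le hα0 (by norm_num) le_rfl hθ

theorem tendsto_circleAverage_log_norm_cosLog {α : ℝ} (hα0 : 0 < α) :
    Tendsto (fun r ↦ circleAverage (Real.log ‖cosLog α ·‖) 0 r) (𝓝[<] 1)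
      (𝓝 (circleAverage (Real.log ‖cosLog α ·‖) 0 1)) := by
  refine Tendsto.smul tendsto_const_nhds ?_
  refine intervalIntegral.tendsto_integral_filter_of_dominated_convergence _ ?_ ?_
    (intervalIntegrable_log_norm_cosLog_bound α 0 (2 * π)) ?_
  · exact .of_forall fun r ↦ (measurable_log_norm_cosLog α r).aestronglyMeasurable
  · filter_upwards [Ioo_mem_nhdsLT (by norm_num : (1 / 2 : ℝ) < 1)] with r hr
    filter_upwards [ae_sin_ne_zero] with θ hθ _
    exact abs_log_norm_cosLog_circleMap_le hα0 hr.1.le hr.2.le hθ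
  · filter_upwards [ae_sin_ne_zero] with θ hθ _
    have him : (1 + circleMap 0 1 θ).im ≠ 0 := by simpa [circleMap_zero_im] using hθ
    have hslit : 1 + circleMap 0 1 θ ∈ Complex.slitPlane := .inr him
    have hne : cosLog α (circleMap 0 1 θ) ≠ 0 := by
      refine norm_pos_iff.mp (lt_of_lt_of_le ?_ (Complex.abs_im_le_norm_cos _))
      rw [im_log_div]
      refine abs_pos.mpr (div_ne_zero (fun h ↦ him ?_) (by positivity))
      exact (Complex.arg_eq_zero_iff.mp h).2
    refine Tendsto.log (Tendsto.norm ?_) (norm_ne_zero_iff.mpr hne)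
    refine (hasDerivAt_cosLog α hslit).continuousAt.tendsto.comp ?_
    have : Continuous fun r : ℝ ↦ circleMap 0 r θ := by unfold circleMap; fun_prop
    exact (this.tendsto 1).mono_left nhdsWithin_le_nhds

theorem circleAverage_log_norm_cosLog_one {α : ℝ} (hα0 : 0 < α) (hα : Real.log 2 / π < α) :
    circleAverage (Real.log ‖cosLog α ·‖) 0 1
      = ∑' k : ℕ, Real.log (-cosLogZero α k)⁻¹ := by
  refine tendsto_nhds_unique (tendsto_circleAverage_log_norm_cosLog hα0)
    ((tendsto_tsum_max_log hα0).congr' ?_)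
  filter_upwards [Ioo_mem_nhdsLT (zero_lt_one (α := ℝ))] with r hr
  exact (circleAverage_log_norm_cosLog hα0 hα hr.1 hr.2).symm

theorem one_add_circleMap_two_mul (x : ℝ) :
    1 + circleMap 0 1 (2 * x) = (2 * Real.cos x : ℝ) * Complex.exp (x * Complex.I) := by
  have h : Complex.exp (x * Complex.I) * Complex.exp (-(x * Complex.I)) = 1 := by
    rw [← Complex.exp_add]; simp
  have h2 : circleMap 0 1 (2 * x) = Complex.exp (x * Complex.I) * Complex.exp (x * Complex.I) := by
    rw [← Complex.exp_add, circleMap_zero]; push_cast; ring_nf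
  rw [h2]
  push_cast
  rw [Complex.cos, neg_mul]
  linear_combination -h

theorem log_cosh_add_cos {α : ℝ} (hα0 : 0 < α) {x : ℝ} (hx : x ∈ Set.Ioo (-(π / 2)) (π / 2))
    (hx0 : x ≠ 0) :
    Real.log (Real.cosh (x / α) + Real.cos (Real.log (2 * Real.cos x) / α))
      = Real.log 2 + 2 * Real.log ‖cosLog α (circleMap 0 1 (2 * x))‖ := by
  have hcos : 0 < 2 * Real.cos x := by linarith [Real.cos_pos_of_mem_Ioo hx]
  have hsq := Complex.norm_cos_sq (Complex.log (1 + circleMap 0 1 (2 * x)) / (2 * α))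
  rw [im_log_div, re_log_div, one_add_circleMap_two_mul, Complex.arg_real_mul _ hcos,
    Complex.arg_exp_mul_I, (toIocMod_eq_self _).mpr ⟨by linarith [hx.1, pi_pos],
      by linarith [hx.2, pi_pos]⟩, norm_mul, Complex.norm_exp_ofReal_mul_I, Complex.norm_real,
    Real.norm_of_nonneg hcos.le, mul_one, mul_div, mul_div, mul_div_mul_left _ _ two_ne_zero, mul_div_mul_left _ _ two_ne_zero]
    at hsq
  have hpos : 0 < ‖cosLog α (circleMap 0 1 (2 * x))‖ := by
    have := Real.one_lt_cosh.mpr (div_ne_zero hx0 hα0.ne')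
    have := Real.neg_one_le_cos (Real.log (2 * Real.cos x) / α)
    rw [cosLog, one_add_circleMap_two_mul]
    refine (norm_nonneg _).lt_of_ne' (pow_ne_zero_iff two_ne_zero |>.mp ?_)
    rw [hsq]
    linarith
  rw [cosLog, one_add_circleMap_two_mul] at hpos ⊢
  rw [← Real.log_rpow hpos, ← Real.log_mul two_ne_zero (by positivity), Real.rpow_two, hsq]
  congr 1
  ring

theorem integral_log_cosh_add_cos {α : ℝ} (hα0 : 0 < α) :
    ∫ x in (0 : ℝ)..(π / 2), Real.log (Real.cosh (x / α) + Real.cos (Real.log (2 * Real.cos x) / α))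
      = π / 2 * Real.log 2 + π * circleAverage (Real.log ‖cosLog α ·‖) 0 1 := by
  set G : ℝ → ℝ := fun x ↦
    Real.log (Real.cosh (x / α) + Real.cos (Real.log (2 * Real.cos x) / α)) with hG
  set F : ℝ → ℝ := fun θ ↦ Real.log ‖cosLog α (circleMap 0 1 θ)‖ with hF
  have hFint (a b : ℝ) : IntervalIntegrable F volume a b :=
    intervalIntegrable_log_norm_cosLog hα0 a b
  have hFint2 (a b : ℝ) : IntervalIntegrable (fun x ↦ 2 * F (2 * x)) volume a b := by
    have := (hFint (2 * a) (2 * b)).comp_mul_left (c := 2)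
    simp only [mul_div_cancel_left₀ _ (two_ne_zero (α := ℝ))] at this
    exact this.const_mul 2
  have hGH {a b : ℝ} (ha : -(π / 2) ≤ a) (hab : a ≤ b) (hb : b ≤ π / 2) :
      ∫ x in a..b, G x = ∫ x in a..b, (Real.log 2 + 2 * F (2 * x)) := by
    refine intervalIntegral.integral_congr_ae ?_
    filter_upwards [Measure.ae_ne volume 0, Measure.ae_ne volume (π / 2)] with x hx0 hx1 hx
    rw [Set.uIoc_of_le hab] at hx
    exact log_cosh_add_cos hα0
      ⟨ha.trans_lt hx.1, lt_of_le_of_ne (hx.2.trans hb) hx1⟩ hx0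
  have hpi : (0 : ℝ) ≤ π / 2 := by positivity
  have heven : ∫ x in (-(π / 2))..0, G x = ∫ x in (0 : ℝ)..(π / 2), G x := by
    have := intervalIntegral.integral_comp_neg (a := 0) (b := π / 2) G
    rw [neg_zero] at this
    rw [← this]
    simp [hG, neg_div]
  have hper : Function.Periodic F (2 * π) := fun θ ↦ by
    simp only [hF, periodic_circleMap 0 1 θ]
  have havg : ∫ x in (-π)..π, F x = 2 * π * circleAverage (Real.log ‖cosLog α ·‖) 0 1 := by
    have := hper.intervalIntegral_add_eq (-π) 0
    rw [show -π + 2 * π = π by ring, zero_add] at this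
    rw [this, circleAverage, smul_eq_mul, mul_inv_cancel_left₀ (by positivity)]
  have hsum : (∫ x in (-(π / 2))..0, G x) + ∫ x in (0 : ℝ)..(π / 2), G x
      = π * Real.log 2 + 2 * π * circleAverage (Real.log ‖cosLog α ·‖) 0 1 := by
    rw [hGH le_rfl (by linarith) hpi, hGH (by linarith) hpi le_rfl,
      intervalIntegral.integral_add_adjacent_intervals
        (intervalIntegrable_const.add (hFint2 _ _)) (intervalIntegrable_const.add (hFint2 _ _)),
      intervalIntegral.integral_add intervalIntegrable_const (hFint2 _ _),
      intervalIntegral.integral_const, intervalIntegral.integral_const_mul,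
      intervalIntegral.integral_comp_mul_left F two_ne_zero, ← havg]
    simp only [smul_eq_mul, mul_neg, mul_div_cancel₀ π (two_ne_zero (α := ℝ))]
    ring
  linarith

theorem stmt_6 (α : ℝ) (hα : Real.log 2 / π < α) :
    ∫ x in (0:ℝ)..(π/2), Real.log (Real.cosh (x/α) + Real.cos (Real.log (2 * Real.cos x) / α))
      = (π/2) * Real.log 2
        + π * Real.log (∏' n : ℕ, (1 + Real.exp (-π * α * (n+1)))) := by
  have hα0 : 0 < α := lt_trans (div_pos (Real.log_pos one_lt_two) pi_pos) hα
  have hprod : Real.log (∏' n : ℕ, (1 + Real.exp (-π * α * (n + 1))))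
      = ∑' n : ℕ, Real.log (1 + Real.exp (-(π * α) * (n + 1))) := by
    simp_rw [neg_mul π α]
    rw [← Real.rexp_tsum_eq_tprod (fun n ↦ by positivity)
      (Real.summable_log_one_add_of_summable (summable_exp_neg_mul (by positivity))), Real.log_exp]
  rw [integral_log_cosh_add_cos hα0, circleAverage_log_norm_cosLog_one hα0 hα, hprod,
    tsum_log_one_add_exp (by positivity), ← tsum_neg]
  congr! 4 with k
  rw [Real.log_inv, cosLogZero, neg_sub, neg_mul π α]
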